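/- The abelianization of an SB-generated group is finitely generated. -/

import Mathlib

open Pointwise

/-- `d` is a left-invariant metric on the group `G`. -/
def IsLeftInvMetric {G : Type*} [Group G] (d : G → G → ℝ) : Prop :=
  (∀ x y, d x y = 0 ↔ x = y) ∧ (∀ x y, d x y = d y x) ∧
    (∀ x y z, d x z ≤ d x y + d y z) ∧ (∀ k x y, d (k * x) (k * y) = d x y)

/-- `d` is a left-invariant pseudo-metric on the group `G`. -/
def IsLeftInvPseudoMetric {G : Type*} [Group G] (d : G → G → ℝ) : Prop :=
  (∀ x, d x x = 0) ∧ (∀ x y, d x y = d y x) ∧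
    (∀ x y z, d x z ≤ d x y + d y z) ∧ (∀ k x y, d (k * x) (k * y) = d x y)

/-- A subset of a group is strongly bounded if it has finite diameter in every
left-invariant metric on the group. -/
def StronglyBounded {G : Type*} [Group G] (A : Set G) : Prop :=
  ∀ d : G → G → ℝ, IsLeftInvMetric d → ∃ D : ℝ, ∀ a ∈ A, ∀ b ∈ A, d a b ≤ D

/-- The word length of `g` with respect to `S`: the least `n` with `g ∈ S^n`. -/
noncomputable def wordLength {G : Type*} [Group G] (S : Set G) (g : G) : ℕ :=
  sInf {n : ℕ | g ∈ S ^ n}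

/-- The word metric associated to a generating set `S`. -/
noncomputable def wordMetric {G : Type*} [Group G] (S : Set G) (g h : G) : ℝ :=
  (wordLength S (h⁻¹ * g) : ℝ)

/-- A group is SB-generated if it is generated by a strongly bounded subset. -/
def SBGenerated (G : Type*) [Group G] : Prop :=
  ∃ S : Set G, StronglyBounded S ∧ Subgroup.closure S = ⊤


lemma exists_countable_nonfg {A : Type*} [AddCommGroup A] (hA : ¬ Module.Finite ℤ A) :
    ∃ T : Set A, T.Countable ∧ ¬ (Submodule.span ℤ T).FG := by
  classical
  have h1 : ∀ s : Finset A, ∃ y, y ∉ Submodule.span ℤ (s : Set A) := by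
    intro s
    by_contra! hc
    exact hA ⟨⟨s, by rw [eq_top_iff]; exact fun y _ => hc y⟩⟩
  choose y hy using h1
  obtain ⟨s, hs⟩ : ∃ s : ℕ → Finset A, ∀ n, s (n+1) = insert (y (s n)) (s n) :=
    ⟨fun n => Nat.rec ∅ (fun _ t => insert (y t) t) n, fun n => rfl⟩
  have hmono : Monotone fun n : ℕ => Submodule.span ℤ (↑(s n) : Set A) := by
    apply monotone_nat_of_le_succ
    intro n
    apply Submodule.span_mono
    rw [hs]
    simp
  refine ⟨⋃ n : ℕ, (↑(s n) : Set A), Set.countable_iUnion fun n => (s n).countable_toSet, ?_⟩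
  intro hfg
  obtain ⟨n, hn⟩ := hfg.stabilizes_of_iSup_eq ⟨_, hmono⟩ (by
    rw [Submodule.span_iUnion]; rfl)
  have h2 : y (s n) ∈ Submodule.span ℤ (⋃ n : ℕ, (↑(s n) : Set A)) := by
    apply Submodule.subset_span
    refine Set.mem_iUnion.2 ⟨n+1, ?_⟩
    rw [hs]; simp
  rw [hn] at h2
  exact hy _ h2

lemma exists_hom_countable.{u} {A : Type u} [AddCommGroup A] (T : Set A) (hT : T.Countable) :
    ∃ (D : Type u) (_ : AddCommGroup D) (_ : Countable D) (f : A →ₗ[ℤ] D),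
      Function.Injective (f ∘ₗ (Submodule.span ℤ T).subtype) := by
  classical
  have : Countable T := hT.to_subtype
  let F := Finsupp.linearCombination ℤ ((↑) : T → A)
  let i : (T →₀ ℤ) →ₗ[ℤ] (T →₀ ℚ) := Finsupp.mapRange.linearMap (Int.castAddHom ℚ).toIntLinearMap
  have hi : Function.Injective i := by
    apply Finsupp.mapRange_injective _ (by simp)
    exact Int.cast_injective
  let R := (LinearMap.ker F).map i
  let D := (T →₀ ℚ) ⧸ R
  have : Countable (T →₀ ℚ) := inferInstance
  have hcD : Countable D := Quotient.countable
  let : DivisibleBy D ℤ := by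
    refine divisibleByOfSMulRightSurj _ _ ?_
    intro n hn d
    obtain ⟨v, rfl⟩ := Submodule.mkQ_surjective R d
    refine ⟨R.mkQ ((n : ℚ)⁻¹ • v), ?_⟩
    change n • R.mkQ ((n : ℚ)⁻¹ • v) = _
    rw [← map_zsmul]
    congr 1
    ext t
    have : (n : ℚ) ≠ 0 := by exact_mod_cast hn
    simp [this]
  have hker : LinearMap.ker (R.mkQ ∘ₗ i) = LinearMap.ker F := by
    rw [LinearMap.ker_comp, Submodule.ker_mkQ, Submodule.comap_map_eq_of_injective hi]
  let g0 : ((T →₀ ℤ) ⧸ LinearMap.ker F) →ₗ[ℤ] D := (LinearMap.ker F).liftQ (R.mkQ ∘ₗ i) hker.ge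
  have hg0 : Function.Injective g0 := by
    rw [← LinearMap.ker_eq_bot]
    exact Submodule.ker_liftQ_eq_bot _ _ _ hker.le
  have hr : LinearMap.range F = Submodule.span ℤ T := by
    rw [Finsupp.range_linearCombination]; simp
  let g : LinearMap.range F →ₗ[ℤ] D := g0 ∘ₗ F.quotKerEquivRange.symm.toLinearMap
  have hg : Function.Injective g := hg0.comp F.quotKerEquivRange.symm.injective
  obtain ⟨f, hf⟩ := (Module.Baer.of_divisible D).extension_property
    (LinearMap.range F).subtype (Submodule.subtype_injective _) g
  refine ⟨D, inferInstance, hcD, f, ?_⟩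
  rw [← hr, hf]
  exact hg

lemma sb_countable {G : Type*} [Group G] (h : SBGenerated G) {D : Type*} [AddCommGroup D]
    [Countable D] (f : G →* Multiplicative D) :
    ∃ N : Submodule ℤ D, N.FG ∧ ∀ g, (f g).toAdd ∈ N := by
  classical
  obtain ⟨S, hS, hgen⟩ := h
  obtain ⟨e, he⟩ := exists_surjective_nat D
  let N : ℕ → Submodule ℤ D := fun n => Submodule.span ℤ (e '' Set.Iic n)
  have hN : Monotone N := fun a b hab =>
    Submodule.span_mono (Set.image_mono (Set.Iic_subset_Iic.2 hab))
  have hfg : ∀ n, (N n).FG := fun n => Submodule.fg_span ((Set.finite_Iic n).image e)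
  have hex : ∀ d, ∃ n, d ∈ N n := by
    intro d
    obtain ⟨n, rfl⟩ := he d
    exact ⟨n, Submodule.subset_span ⟨n, by simp, rfl⟩⟩
  let r : D → ℕ := fun d => Nat.find (hex d)
  have hr : ∀ d, d ∈ N (r d) := fun d => Nat.find_spec (hex d)
  have hrle : ∀ d n, d ∈ N n → r d ≤ n := fun d n h => Nat.find_min' (hex d) h
  have hneg : ∀ d, r (-d) = r d := by
    have : ∀ d, r (-d) ≤ r d := fun d => hrle _ _ (neg_mem (hr d))
    intro d
    refine le_antisymm (this d) ?_
    simpa using this (-d)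
  have hadd : ∀ a b, r (a + b) ≤ r a + r b := fun a b =>
    hrle _ _ (add_mem (hN (Nat.le_add_right _ _) (hr a)) (hN (Nat.le_add_left _ _) (hr b)))
  let l : G → ℕ := fun g => r (f g).toAdd
  have hlinv : ∀ g, l g⁻¹ = l g := by
    intro g
    simp only [l, map_inv, toAdd_inv, hneg]
  have hlmul : ∀ g k, l (g * k) ≤ l g + l k := by
    intro g k
    simp only [l, map_mul, toAdd_mul, hadd]
  let d : G → G → ℝ := fun x y => if x = y then 0 else 1 + (l (x⁻¹ * y) : ℝ)
  have hd : IsLeftInvMetric d := by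
    refine ⟨?_, ?_, ?_, ?_⟩
    · intro x y
      by_cases hxy : x = y
      · simp [d, hxy]
      · simp only [d, hxy, if_false, iff_false]
        positivity
    · intro x y
      have : l (x⁻¹ * y) = l (y⁻¹ * x) := by
        rw [← hlinv]; simp
      simp only [d, this, eq_comm]
    · intro x y z
      by_cases hxy : x = y
      · subst hxy; simp [d]
      by_cases hyz : y = z
      · subst hyz; simp [d]
      have h3 : (l (x⁻¹ * z) : ℝ) ≤ l (x⁻¹ * y) + l (y⁻¹ * z) := by
        have := hlmul (x⁻¹ * y) (y⁻¹ * z)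
        rw [show x⁻¹ * y * (y⁻¹ * z) = x⁻¹ * z by group] at this
        exact_mod_cast this
      simp only [d, hxy, hyz, if_false]
      split_ifs
      · positivity
      · linarith
    · intro k x y
      simp only [d, mul_right_inj]
      rw [show (k * x)⁻¹ * (k * y) = x⁻¹ * y by group]
  obtain ⟨B, hB⟩ := hS d hd
  have key : ∃ m, ∀ s ∈ S, (f s).toAdd ∈ N m := by
    rcases S.eq_empty_or_nonempty with rfl | ⟨a, ha⟩
    · exact ⟨0, by simp⟩
    · obtain ⟨b, hb⟩ := exists_nat_ge B
      refine ⟨l a + b, fun s hs => ?_⟩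
      by_cases has : a = s
      · subst has
        exact hN (Nat.le_add_right _ _) (hr _)
      have h4 := hB a ha s hs
      simp only [d, has, if_false] at h4
      have h5 : l (a⁻¹ * s) ≤ b := by
        have : (l (a⁻¹ * s) : ℝ) ≤ b := by linarith
        exact_mod_cast this
      have h6 := hlmul a (a⁻¹ * s)
      rw [mul_inv_cancel_left] at h6
      exact hN (h6.trans (by omega)) (hr _)
  obtain ⟨m, hm⟩ := key
  refine ⟨N m, hfg m, fun g => ?_⟩
  have hg : g ∈ Subgroup.closure S := by rw [hgen]; trivial
  induction hg using Subgroup.closure_induction with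
  | mem x hx => exact hm x hx
  | one => simp
  | mul x y _ _ hx hy => rw [map_mul, toAdd_mul]; exact add_mem hx hy
  | inv x _ hx => rw [map_inv, toAdd_inv]; exact neg_mem hx

theorem stmt14 {G : Type*} [Group G] (h : SBGenerated G) :
    Group.FG (Abelianization G) := by
  have key : Module.Finite ℤ (Additive (Abelianization G)) := by
    by_contra hA
    obtain ⟨T, hT, hnf⟩ := exists_countable_nonfg hA
    obtain ⟨D, _, _, f, hf⟩ := exists_hom_countable T hT
    obtain ⟨N, hN, hfN⟩ := sb_countable h
      ((AddMonoidHom.toMultiplicativeRight f.toAddMonoidHom).comp Abelianization.of)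
    have hall : ∀ a, f a ∈ N := by
      intro a
      obtain ⟨g, hg⟩ := QuotientGroup.mk_surjective a.toMul
      have := hfN g
      have e : a = Additive.ofMul (Abelianization.of g) := by
        rw [← ofMul_toMul a, ← hg]; rfl
      rw [e]
      exact this
    have : Module.Finite ℤ N := Module.Finite.iff_fg.2 hN
    have : IsNoetherian ℤ N := inferInstance
    have hinj : Function.Injective
        ((f ∘ₗ (Submodule.span ℤ T).subtype).codRestrict N (fun c => hall _)) := by
      intro a b hab
      exact hf (congrArg Subtype.val hab)
    have : IsNoetherian ℤ (Submodule.span ℤ T) := isNoetherian_of_injective _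
      hinj
    exact hnf (Module.Finite.iff_fg.1 inferInstance)
  rw [Group.fg_iff_monoid_fg, Monoid.fg_iff_add_fg, ← AddGroup.fg_iff_addMonoid_fg]
  exact Module.Finite.iff_addGroup_fg.1 key
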